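/- arXiv:2201.11057 — 2 statements merged into one kernel-verified Lean document; each statement's English description precedes it below -/
import Mathlib

section
/- The subgroup of Sym(Fin 11) generated by the 11-cycle (0 1 2 3 4 5 6 7 8 9 10) and the permutation (4 5 3 9)(10 7 2 6) acts 4-transitively on 11 points and has order 11!/5040 = 7920 (this is the Mathieu group M11). -/
def IsMultiplyTransitive {X : Type*} (G : Subgroup (Equiv.Perm X)) (k : ℕ) : Prop :=
  ∀ v w : Fin k → X, Function.Injective v → Function.Injective w →
    ∃ g ∈ G, ∀ i, g (v i) = w i

/-- The 4-cycle `(a b c d)` as a product of transpositions. -/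
def cycle4 {X : Type*} [DecidableEq X] (a b c d : X) : Equiv.Perm X :=
  Equiv.swap a b * Equiv.swap b c * Equiv.swap c d

open scoped Pointwise

namespace Mathieu

/-- The second generator of `M11`. -/
abbrev quadCycle : Equiv.Perm (Fin 11) := cycle4 (4 : Fin 11) 5 3 9 * cycle4 10 7 2 6

/-- The Mathieu group `M11` as a group of permutations. -/
abbrev M11 : Subgroup (Equiv.Perm (Fin 11)) := Subgroup.closure {finRotate 11, quadCycle}

/-- The binary code of a set of points. -/
def code (s : Finset (Fin 11)) : ℕ := ∑ i ∈ s, 2 ^ (i : ℕ)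

theorem code_injective : Function.Injective code := fun s t h => by
  have h' : (s.map Fin.valEmbedding) = t.map Fin.valEmbedding :=
    Finset.geomSum_injective le_rfl (by simpa [code] using h)
  exact Finset.map_injective _ h'

/-- The codes of the blocks of a Steiner system `S(4, 5, 11)`. These are the translates of
`{0, 1, 2, 3, 9}`, `{0, 1, 2, 4, 7}`, `{0, 1, 2, 5, 6}`, `{0, 1, 3, 4, 8}`, `{0, 1, 3, 5, 7}` and
`{0, 1, 4, 6, 9}`; translating by `1` doubles the code modulo `2 ^ 11 - 1`. -/
def blockCodes : List ℕ :=
  (List.range 11).flatMap fun k => [527, 151, 103, 283, 171, 595].map fun n => n * 2 ^ k % 2047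

/-- A block of the Steiner system. -/
abbrev IsBlock (s : Finset (Fin 11)) : Prop := code s ∈ blockCodes

theorem code_smul (g : Equiv.Perm (Fin 11)) (s : Finset (Fin 11)) :
    code (g • s) = ∑ i ∈ s, 2 ^ (g i : ℕ) :=
  Finset.sum_image g.injective.injOn

theorem code_filter_testBit :
    ∀ n ∈ blockCodes, ∑ i : Fin 11, (if n.testBit i then 2 ^ (i : ℕ) else 0) = n := by
  decide +kernel

/-- A permutation mapping blocks to blocks, as a condition on the codes. -/
theorem isBlock_smul {g : Equiv.Perm (Fin 11)}
    (hg : ∀ n ∈ blockCodes, ∑ i : Fin 11, (if n.testBit i then 2 ^ (g i : ℕ) else 0) ∈ blockCodes)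
    {s : Finset (Fin 11)} (hs : IsBlock s) : IsBlock (g • s) := by
  have h : s = Finset.univ.filter fun i : Fin 11 => (code s).testBit i :=
    code_injective (by
      conv_rhs => rw [code, Finset.sum_filter]
      exact (code_filter_testBit _ hs).symm)
  have := hg _ hs
  rw [← Finset.sum_filter, ← h, ← code_smul] at this
  exact this

theorem isBlock_finRotate_smul {s : Finset (Fin 11)} (hs : IsBlock s) :
    IsBlock (finRotate 11 • s) :=
  isBlock_smul (by decide +kernel) hs

theorem isBlock_quadCycle_smul {s : Finset (Fin 11)} (hs : IsBlock s) :
    IsBlock (quadCycle • s) :=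
  isBlock_smul (by decide +kernel) hs

theorem isBlock_smul_of_mem {g : Equiv.Perm (Fin 11)} (hg : g ∈ M11) {s : Finset (Fin 11)}
    (hs : IsBlock s) : IsBlock (g • s) := by
  let blocks : Finset (Finset (Fin 11)) := {s | IsBlock s}
  have mem_blocks : ∀ s, s ∈ blocks ↔ IsBlock s := fun _ => Finset.mem_filter_univ _
  have h : M11 ≤ MulAction.stabilizer (Equiv.Perm (Fin 11)) blocks := by
    rw [Subgroup.closure_le]
    rintro x (rfl | rfl) <;> refine MulAction.mem_stabilizer_finset'.2 fun s hs => ?_ <;>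
      rw [mem_blocks] at hs ⊢
    · exact isBlock_finRotate_smul hs
    · exact isBlock_quadCycle_smul hs
  exact (mem_blocks _).1 (MulAction.mem_stabilizer_finset'.1 (h hg) ((mem_blocks s).2 hs))

theorem eq_five_of_isBlock : ∀ x₅ : Fin 11, x₅ ≠ 3 → x₅ ≠ 9 →
    ∀ x₄, IsBlock {0, 2, 3, x₄, x₅} → IsBlock {1, 2, 9, x₄, x₅} →
    ∀ x₇, IsBlock {0, 1, 3, x₅, x₇} → IsBlock {0, 1, 2, x₄, x₇} → x₅ = 5 := by
  decide +kernel

theorem eq_one_of_fixes {g : Equiv.Perm (Fin 11)} (hg : g ∈ M11) (h₀ : g 0 = 0) (h₁ : g 1 = 1)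
    (h₂ : g 2 = 2) (h₃ : g 3 = 3) : g = 1 := by
  have key : ∀ a b c d e : Fin 11, IsBlock {a, b, c, d, e} →
      IsBlock {g a, g b, g c, g d, g e} := fun a b c d e h => by
    have := isBlock_smul_of_mem hg h
    simpa only [Finset.smul_finset_insert, Finset.smul_finset_singleton, Equiv.Perm.smul_def]
      using this
  have fixes : ∀ a b c d e : Fin 11, g a = a → g b = b → g c = c → g d = d →
      IsBlock {a, b, c, d, e} → (∀ x, IsBlock {a, b, c, d, x} → x = e) → g e = e :=
    fun a b c d e ha hb hc hd h unique => unique _ (by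
      have := key a b c d e h
      rwa [ha, hb, hc, hd] at this)
  have h₉ : g 9 = 9 := fixes 0 1 2 3 9 h₀ h₁ h₂ h₃ (by decide +kernel) (by decide +kernel)
  have h₅ : g 5 = 5 := by
    have k₁ := key 0 2 3 4 5 (by decide +kernel)
    have k₂ := key 1 2 9 4 5 (by decide +kernel)
    have k₃ := key 0 1 3 5 7 (by decide +kernel)
    have k₄ := key 0 1 2 4 7 (by decide +kernel)
    rw [h₀, h₂, h₃] at k₁
    rw [h₁, h₂, h₉] at k₂
    rw [h₀, h₁, h₃] at k₃
    rw [h₀, h₁, h₂] at k₄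
    exact eq_five_of_isBlock (g 5)
      (fun h => absurd (g.injective (h.trans h₃.symm)) (by decide))
      (fun h => absurd (g.injective (h.trans h₉.symm)) (by decide)) _ k₁ k₂ _ k₃ k₄
  have h₄ : g 4 = 4 := fixes 0 2 3 5 4 h₀ h₂ h₃ h₅ (by decide +kernel) (by decide +kernel)
  have h₆ : g 6 = 6 := fixes 0 1 2 5 6 h₀ h₁ h₂ h₅ (by decide +kernel) (by decide +kernel)
  have h₇ : g 7 = 7 := fixes 0 1 3 5 7 h₀ h₁ h₃ h₅ (by decide +kernel) (by decide +kernel)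
  have h₈ : g 8 = 8 := fixes 0 1 3 4 8 h₀ h₁ h₃ h₄ (by decide +kernel) (by decide +kernel)
  have h₁₀ : g 10 = 10 := fixes 0 2 3 7 10 h₀ h₂ h₃ h₇ (by decide +kernel) (by decide +kernel)
  refine Equiv.ext fun i => ?_
  fin_cases i
  exacts [h₀, h₁, h₂, h₃, h₄, h₅, h₆, h₇, h₈, h₉, h₁₀]

theorem finRotate_mem : finRotate 11 ∈ M11 := Subgroup.subset_closure (by simp)

theorem quadCycle_mem : quadCycle ∈ M11 := Subgroup.subset_closure (by simp)

/-- The alternating product `s ^ k * t * s ^ l * t * ...` of powers of the 11-cycle `s` with the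
second generator `t`, for the list of exponents `[k, l, ...]`. -/
def word : List (Fin 11) → Equiv.Perm (Fin 11)
  | [] => 1
  | [k] => finRotate 11 ^ (k : ℕ)
  | k :: l => finRotate 11 ^ (k : ℕ) * quadCycle * word l

theorem word_mem : ∀ l, word l ∈ M11
  | [] => one_mem _
  | [k] => pow_mem finRotate_mem k
  | k :: m :: l =>
    mul_mem (mul_mem (pow_mem finRotate_mem k) quadCycle_mem) (word_mem (m :: l))

/-- The action of `word l` on points, in a form that evaluates quickly. -/
def wordFun : List (Fin 11) → Fin 11 → Fin 11
  | [], x => x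
  | [k], x => x + k
  | k :: l, x => ![0, 1, 6, 9, 5, 3, 10, 2, 8, 4, 7] (wordFun l x) + k

theorem finRotate_pow_apply : ∀ k x : Fin 11, (finRotate 11 ^ (k : ℕ)) x = x + k := by
  decide +kernel

theorem quadCycle_apply :
    ∀ x, quadCycle x = (![0, 1, 6, 9, 5, 3, 10, 2, 8, 4, 7] : Fin 11 → Fin 11) x := by
  decide +kernel

theorem word_apply : ∀ l x, word l x = wordFun l x
  | [], _ => rfl
  | [k], x => finRotate_pow_apply k x
  | k :: m :: l, x => by
    rw [word, wordFun, Equiv.Perm.mul_apply, Equiv.Perm.mul_apply, word_apply (m :: l),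
      quadCycle_apply, finRotate_pow_apply]
    all_goals simp

theorem word_pow_mul_word_pow_apply (l m : List (Fin 11)) (i j : ℕ) (x : Fin 11) :
    (word l ^ i * word m ^ j) x = (wordFun l)^[i] ((wordFun m)^[j] x) := by
  have h : ∀ l, ⇑(word l) = wordFun l := fun l => funext (word_apply l)
  rw [Equiv.Perm.mul_apply, Equiv.Perm.coe_pow, Equiv.Perm.coe_pow, h, h]

theorem exists_map_zero (x : Fin 11) : ∃ g ∈ M11, g x = 0 :=
  ⟨word [-x], word_mem _, by rw [word_apply, wordFun, add_neg_cancel]⟩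

theorem exists_map_one (x : Fin 11) (h₀ : x ≠ 0) : ∃ g ∈ M11, g 0 = 0 ∧ g x = 1 := by
  have h : ∀ x : Fin 11, x ≠ 0 → ∃ i < 4, ∃ j < 4,
      (word [2, 3] ^ i * word [4, 10] ^ j) 0 = 0 ∧
      (word [2, 3] ^ i * word [4, 10] ^ j) x = 1 := by
    simp only [word_pow_mul_word_pow_apply]
    decide +kernel
  obtain ⟨i, -, j, -, hx⟩ := h x h₀
  exact ⟨_, mul_mem (pow_mem (word_mem _) i) (pow_mem (word_mem _) j), hx⟩

theorem exists_map_two (x : Fin 11) (h₀ : x ≠ 0) (h₁ : x ≠ 1) :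
    ∃ g ∈ M11, g 0 = 0 ∧ g 1 = 1 ∧ g x = 2 := by
  have h : ∀ x : Fin 11, x ≠ 0 → x ≠ 1 → ∃ i < 4, ∃ j < 4,
      (word [0, 0] ^ i * word [1, 5, 1] ^ j) 0 = 0 ∧
      (word [0, 0] ^ i * word [1, 5, 1] ^ j) 1 = 1 ∧
      (word [0, 0] ^ i * word [1, 5, 1] ^ j) x = 2 := by
    simp only [word_pow_mul_word_pow_apply]
    decide +kernel
  obtain ⟨i, -, j, -, hx⟩ := h x h₀ h₁
  exact ⟨_, mul_mem (pow_mem (word_mem _) i) (pow_mem (word_mem _) j), hx⟩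

theorem exists_map_three (x : Fin 11) (h₀ : x ≠ 0) (h₁ : x ≠ 1) (h₂ : x ≠ 2) :
    ∃ g ∈ M11, g 0 = 0 ∧ g 1 = 1 ∧ g 2 = 2 ∧ g x = 3 := by
  have h : ∀ x : Fin 11, x ≠ 0 → x ≠ 1 → x ≠ 2 → ∃ i < 4, ∃ j < 4,
      (word [1, 3, 6, 6] ^ i * word [2, 6, 4, 9] ^ j) 0 = 0 ∧
      (word [1, 3, 6, 6] ^ i * word [2, 6, 4, 9] ^ j) 1 = 1 ∧
      (word [1, 3, 6, 6] ^ i * word [2, 6, 4, 9] ^ j) 2 = 2 ∧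
      (word [1, 3, 6, 6] ^ i * word [2, 6, 4, 9] ^ j) x = 3 := by
    simp only [word_pow_mul_word_pow_apply]
    decide +kernel
  obtain ⟨i, -, j, -, hx⟩ := h x h₀ h₁ h₂
  exact ⟨_, mul_mem (pow_mem (word_mem _) i) (pow_mem (word_mem _) j), hx⟩

theorem exists_map_base (v : Fin 4 → Fin 11) (hv : Function.Injective v) :
    ∃ g ∈ M11, ∀ i, g (v i) = Fin.castLE (by decide) i := by
  have ne : ∀ (g : Equiv.Perm (Fin 11)) {i j : Fin 4} {y : Fin 11}, i ≠ j → g (v i) = y →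
      g (v j) ≠ y := fun g i j y hij hi hj => hij (hv (g.injective (hi.trans hj.symm)))
  obtain ⟨a, ha, a₀⟩ := exists_map_zero (v 0)
  obtain ⟨b, hb, b₀, b₁⟩ := exists_map_one (a (v 1)) (ne a (by decide) a₀)
  have ba₀ : (b * a) (v 0) = 0 := by simp [a₀, b₀]
  obtain ⟨c, hc, c₀, c₁, c₂⟩ := exists_map_two ((b * a) (v 2)) (ne (b * a) (by decide) ba₀)
    (ne (b * a) (i := 1) (by decide) b₁)
  have cba₀ : (c * (b * a)) (v 0) = 0 := by rw [Equiv.Perm.mul_apply, ba₀, c₀]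
  have cba₁ : (c * (b * a)) (v 1) = 1 := by simp [b₁, c₁]
  obtain ⟨d, hd, d₀, d₁, d₂, d₃⟩ := exists_map_three ((c * (b * a)) (v 3))
    (ne _ (by decide) cba₀) (ne _ (i := 1) (by decide) cba₁) (ne _ (i := 2) (by decide) c₂)
  refine ⟨d * (c * (b * a)), mul_mem hd (mul_mem hc (mul_mem hb ha)), fun i => ?_⟩
  rw [Equiv.Perm.mul_apply]
  fin_cases i
  · exact (congrArg d cba₀).trans d₀
  · exact (congrArg d cba₁).trans d₁
  · exact (congrArg d c₂).trans d₂
  · exact d₃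

theorem isMultiplyTransitive : IsMultiplyTransitive M11 4 := fun v w hv hw => by
  obtain ⟨g, hg, hgv⟩ := exists_map_base v hv
  obtain ⟨h, hh, hhw⟩ := exists_map_base w hw
  refine ⟨h⁻¹ * g, mul_mem (inv_mem hh) hg, fun i => ?_⟩
  rw [Equiv.Perm.mul_apply, hgv, Equiv.Perm.inv_eq_iff_eq, hhw]

theorem card_eq : Nat.card M11 = 7920 := by
  let base : Fin 4 ↪ Fin 11 := Fin.castLEEmb (by decide)
  let f : M11 → (Fin 4 ↪ Fin 11) := fun g => base.trans g.1.toEmbedding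
  have hf : Function.Bijective f := by
    constructor
    · intro g h hgh
      have fixes : ∀ i, (h.1⁻¹ * g.1) (base i) = base i := fun i => by
        rw [Equiv.Perm.mul_apply, Equiv.Perm.inv_eq_iff_eq]
        exact DFunLike.congr_fun hgh i
      have := eq_one_of_fixes (mul_mem (inv_mem h.2) g.2) (fixes 0) (fixes 1) (fixes 2) (fixes 3)
      exact Subtype.ext (inv_mul_eq_one.1 this).symm
    · intro w
      obtain ⟨g, hg, hgw⟩ := isMultiplyTransitive base w base.injective w.injective
      exact ⟨⟨g, hg⟩, DFunLike.ext _ _ hgw⟩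
  rw [Nat.card_eq_of_bijective f hf, Nat.card_eq_fintype_card, Fintype.card_embedding_eq]
  decide

end Mathieu

/-- The subgroup of `Sym(Fin 11)` generated by the 11-cycle `(0 1 2 ... 10)` and the
permutation `(4 5 3 9)(10 7 2 6)` acts 4-transitively on 11 points and has order
`11!/5040 = 7920`: it is the Mathieu group `M11`. -/
theorem mathieu_M11 :
    IsMultiplyTransitive
        (Subgroup.closure
          {finRotate 11, cycle4 (4 : Fin 11) 5 3 9 * cycle4 10 7 2 6}) 4 ∧
      Nat.card (Subgroup.closure
          {finRotate 11, cycle4 (4 : Fin 11) 5 3 9 * cycle4 10 7 2 6}) = 7920 ∧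
      7920 = Nat.factorial 11 / 5040 :=
  ⟨Mathieu.isMultiplyTransitive, Mathieu.card_eq, by decide⟩
end

section
/- The Mathieu group M11 (the subgroup of Sym(Fin 11) generated by (0 1 2 3 4 5 6 7 8 9 10) and (4 5 3 9)(10 7 2 6)) contains the 2-transitive group of order 660 generated by (0 1 2 3 4 5 6 7 8 9 10) and (4 3)(5 9)(10 2)(7 6). -/
/-- The involution `(4 3)(5 9)(10 2)(7 6)`. -/
def quadSwap : Equiv.Perm (Fin 11) :=
  Equiv.swap (4 : Fin 11) 3 * Equiv.swap 5 9 * Equiv.swap 10 2 * Equiv.swap 7 6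

theorem quadSwap_apply (x : Fin 11) :
    quadSwap x = (![0, 1, 10, 4, 3, 9, 7, 6, 8, 5, 2] : Fin 11 → Fin 11) x := by
  revert x
  decide +kernel

/-- The group generated by `(0 1 2 3 4 5 6 7 8 9 10)` and `(4 3)(5 9)(10 2)(7 6)`. -/
def biplaneGroup : Subgroup (Equiv.Perm (Fin 11)) :=
  Subgroup.closure {finRotate 11, quadSwap}

/-- Membership in the difference set `{0, 1, 2, 4, 7}` modulo 11, whose characteristic bits are
those of `151`. -/
def inDifferenceSet (x : Fin 11) : Bool :=
  Nat.testBit 151 x.val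

/-- The three points lie in a common block of the biplane whose blocks are the translates of the
difference set `{0, 1, 2, 4, 7}` modulo 11. -/
def IsCoblock (a b c : Fin 11) : Prop :=
  ∃ i : Fin 11, inDifferenceSet (a - i) ∧ inDifferenceSet (b - i) ∧ inDifferenceSet (c - i)

instance (a b c : Fin 11) : Decidable (IsCoblock a b c) := by
  unfold IsCoblock
  infer_instance

theorem isCoblock_add_one (a b c : Fin 11) :
    IsCoblock (a + 1) (b + 1) (c + 1) ↔ IsCoblock a b c := by
  unfold IsCoblock
  rw [← (Equiv.addRight (1 : Fin 11)).exists_congr_right]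
  simp only [Equiv.coe_addRight, add_sub_add_right_eq_sub]

theorem inDifferenceSet_quadSwap (x i : Fin 11) :
    inDifferenceSet (quadSwap x - (![10, 8, 3, 2, 7, 5, 6, 4, 1, 9, 0] : Fin 11 → Fin 11) i) =
      inDifferenceSet (x - i) := by
  rw [quadSwap_apply]
  revert x i
  decide +kernel

theorem IsCoblock.quadSwap {a b c : Fin 11} :
    IsCoblock a b c → IsCoblock (quadSwap a) (quadSwap b) (quadSwap c) := by
  rintro ⟨i, ha, hb, hc⟩
  exact ⟨_, (inDifferenceSet_quadSwap a i).trans ha, (inDifferenceSet_quadSwap b i).trans hb,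
    (inDifferenceSet_quadSwap c i).trans hc⟩

theorem quadSwap_quadSwap (x : Fin 11) : quadSwap (quadSwap x) = x := by
  simp only [quadSwap_apply]
  revert x
  decide +kernel

theorem isCoblock_quadSwap (a b c : Fin 11) :
    IsCoblock (quadSwap a) (quadSwap b) (quadSwap c) ↔ IsCoblock a b c :=
  ⟨fun h => by simpa only [quadSwap_quadSwap] using h.quadSwap, IsCoblock.quadSwap⟩

theorem isCoblock_map {g : Equiv.Perm (Fin 11)} (hg : g ∈ biplaneGroup) (a b c : Fin 11) :
    IsCoblock (g a) (g b) (g c) ↔ IsCoblock a b c := by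
  induction hg using Subgroup.closure_induction generalizing a b c with
  | mem g hg =>
    rcases hg with rfl | rfl
    · simpa only [finRotate_apply] using isCoblock_add_one a b c
    · exact isCoblock_quadSwap a b c
  | one => rfl
  | mul g h _ _ ihg ihh => simp only [Equiv.Perm.mul_apply, ihg, ihh]
  | inv g _ ih => simpa using (ih (g⁻¹ a) (g⁻¹ b) (g⁻¹ c)).symm

theorem eq_three_of_isCoblock_iff (y : Fin 11)
    (h01 : IsCoblock 0 1 y ↔ IsCoblock 0 1 3) (h02 : IsCoblock 0 2 y ↔ IsCoblock 0 2 3)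
    (h12 : IsCoblock 1 2 y ↔ IsCoblock 1 2 3) : y = 3 := by
  revert y
  decide +kernel

theorem eq_of_isCoblock_iff (x y : Fin 11)
    (h01 : IsCoblock 0 1 y ↔ IsCoblock 0 1 x) (h02 : IsCoblock 0 2 y ↔ IsCoblock 0 2 x)
    (h12 : IsCoblock 1 2 y ↔ IsCoblock 1 2 x) (h03 : IsCoblock 0 3 y ↔ IsCoblock 0 3 x)
    (h13 : IsCoblock 1 3 y ↔ IsCoblock 1 3 x) (h23 : IsCoblock 2 3 y ↔ IsCoblock 2 3 x) :
    y = x := by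
  revert x y
  decide +kernel

theorem eq_one_of_fixes {g : Equiv.Perm (Fin 11)} (hg : g ∈ biplaneGroup)
    (h0 : g 0 = 0) (h1 : g 1 = 1) (h2 : g 2 = 2) : g = 1 := by
  have key := isCoblock_map hg
  have k01 := key 0 1
  have k02 := key 0 2
  have k12 := key 1 2
  simp only [h0, h1, h2] at k01 k02 k12
  have h3 : g 3 = 3 := eq_three_of_isCoblock_iff _ (k01 3) (k02 3) (k12 3)
  have k03 := key 0 3
  have k13 := key 1 3
  have k23 := key 2 3
  simp only [h0, h1, h2, h3] at k03 k13 k23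
  ext1 x
  exact eq_of_isCoblock_iff x (g x) (k01 x) (k02 x) (k12 x) (k03 x) (k13 x) (k23 x)

theorem finRotate_mem_biplaneGroup : finRotate 11 ∈ biplaneGroup :=
  Subgroup.subset_closure (Or.inl rfl)

theorem quadSwap_mem_biplaneGroup : quadSwap ∈ biplaneGroup :=
  Subgroup.subset_closure (Or.inr rfl)

theorem exists_mem_biplaneGroup_add (i : Fin 11) :
    ∃ g ∈ biplaneGroup, ∀ x, g x = x + i := by
  induction i using Fin.induction with
  | zero => exact ⟨1, one_mem _, fun x => (add_zero x).symm⟩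
  | succ i ih =>
    obtain ⟨g, hg, hgx⟩ := ih
    refine ⟨finRotate 11 * g, mul_mem finRotate_mem_biplaneGroup hg, fun x => ?_⟩
    rw [Equiv.Perm.mul_apply, finRotate_apply, hgx, add_assoc, Fin.coeSucc_eq_succ]

/-- The word `[i₁, …, iₙ]` acts as the composite of the maps `x ↦ quadSwap x + iₖ`, the last letter
being applied first. -/
def wordAct (w : List (Fin 11)) (x : Fin 11) : Fin 11 :=
  w.foldr (fun i y => (![0, 1, 10, 4, 3, 9, 7, 6, 8, 5, 2] : Fin 11 → Fin 11) y + i) x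

theorem exists_mem_biplaneGroup_wordAct (w : List (Fin 11)) :
    ∃ g ∈ biplaneGroup, ∀ x, g x = wordAct w x := by
  induction w with
  | nil => exact ⟨1, one_mem _, fun _ => rfl⟩
  | cons i w ih =>
    obtain ⟨g, hg, hgx⟩ := ih
    obtain ⟨t, ht, htx⟩ := exists_mem_biplaneGroup_add i
    refine ⟨t * (quadSwap * g), mul_mem ht (mul_mem quadSwap_mem_biplaneGroup hg), fun x => ?_⟩
    rw [Equiv.Perm.mul_apply, Equiv.Perm.mul_apply, htx, quadSwap_apply, hgx]
    rfl

theorem exists_wordAct_one (b : Fin 11) (hb : b ≠ 0) :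
    ∃ w, wordAct w 0 = 0 ∧ wordAct w 1 = b := by
  refine ⟨(![[], [], [5, 7], [1, 5, 8], [1, 7, 7], [1, 2], [8, 4], [0, 8, 4], [3, 8], [2, 5],
    [4, 6]] : Fin 11 → List (Fin 11)) b, ?_⟩
  revert b
  decide +kernel

theorem exists_wordAct_two (c : Fin 11) (h0 : c ≠ 0) (h1 : c ≠ 1) (hc : IsCoblock 0 1 c) :
    ∃ w, wordAct w 0 = 0 ∧ wordAct w 1 = 1 ∧ wordAct w 2 = c := by
  refine ⟨(![[], [], [], [3, 3, 9], [5, 3, 3], [], [2, 8, 8], [1, 4, 5], [], [], [0]] :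
    Fin 11 → List (Fin 11)) c, ?_⟩
  revert c
  decide +kernel

theorem exists_mem_biplaneGroup_pair {a b : Fin 11} (hab : a ≠ b) :
    ∃ g ∈ biplaneGroup, g 0 = a ∧ g 1 = b := by
  obtain ⟨t, ht, htx⟩ := exists_mem_biplaneGroup_add a
  obtain ⟨w, hw0, hw1⟩ := exists_wordAct_one (b - a) (sub_ne_zero.mpr hab.symm)
  obtain ⟨g, hg, hgx⟩ := exists_mem_biplaneGroup_wordAct w
  refine ⟨t * g, mul_mem ht hg, ?_, ?_⟩
  · rw [Equiv.Perm.mul_apply, htx, hgx, hw0, zero_add]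
  · rw [Equiv.Perm.mul_apply, htx, hgx, hw1, sub_add_cancel]

theorem exists_mem_biplaneGroup_triple {a b c : Fin 11} (hab : a ≠ b) (hac : a ≠ c) (hbc : b ≠ c)
    (h : IsCoblock a b c) : ∃ g ∈ biplaneGroup, g 0 = a ∧ g 1 = b ∧ g 2 = c := by
  obtain ⟨t, ht, rfl, rfl⟩ := exists_mem_biplaneGroup_pair hab
  obtain ⟨c, rfl⟩ := t.surjective c
  obtain ⟨w, hw0, hw1, hw2⟩ := exists_wordAct_two c (fun h => hac (h ▸ rfl))
    (fun h => hbc (h ▸ rfl)) ((isCoblock_map ht 0 1 c).mp h)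
  obtain ⟨g, hg, hgx⟩ := exists_mem_biplaneGroup_wordAct w
  refine ⟨t * g, mul_mem ht hg, ?_, ?_, ?_⟩ <;> simp only [Equiv.Perm.mul_apply, *]

/-- Triples of distinct points in a common block. -/
abbrev CoblockTriple : Type :=
  {t : Fin 11 × Fin 11 × Fin 11 //
    t.1 ≠ t.2.1 ∧ t.1 ≠ t.2.2 ∧ t.2.1 ≠ t.2.2 ∧ IsCoblock t.1 t.2.1 t.2.2}

theorem card_coblockTriple : Fintype.card CoblockTriple = 660 := by
  decide +kernel

theorem card_biplaneGroup : Nat.card biplaneGroup = 660 := by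
  have h012 : IsCoblock 0 1 2 := by decide +kernel
  let f (g : biplaneGroup) : CoblockTriple :=
    ⟨(g.1 0, g.1 1, g.1 2), g.1.injective.ne (by decide), g.1.injective.ne (by decide),
      g.1.injective.ne (by decide), (isCoblock_map g.2 0 1 2).mpr h012⟩
  have hf : Function.Bijective f := by
    constructor
    · intro g k hgk
      obtain ⟨h0, h1, h2⟩ : g.1 0 = k.1 0 ∧ g.1 1 = k.1 1 ∧ g.1 2 = k.1 2 := by
        simpa [f] using hgk
      refine Subtype.ext
        (inv_mul_eq_one.mp (eq_one_of_fixes (mul_mem (inv_mem k.2) g.2) ?_ ?_ ?_)).symm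
      · simp [h0]
      · simp [h1]
      · simp [h2]
    · rintro ⟨⟨a, b, c⟩, hab, hac, hbc, h⟩
      obtain ⟨g, hg, rfl, rfl, rfl⟩ := exists_mem_biplaneGroup_triple hab hac hbc h
      exact ⟨⟨g, hg⟩, rfl⟩
  rw [Nat.card_eq_of_bijective f hf, Nat.card_eq_fintype_card, card_coblockTriple]

theorem isMultiplyTransitive_biplaneGroup : IsMultiplyTransitive biplaneGroup 2 := by
  intro v w hv hw
  obtain ⟨g, hg, hg0, hg1⟩ := exists_mem_biplaneGroup_pair (hv.ne (zero_ne_one (α := Fin 2)))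
  obtain ⟨k, hk, hk0, hk1⟩ := exists_mem_biplaneGroup_pair (hw.ne (zero_ne_one (α := Fin 2)))
  refine ⟨k * g⁻¹, mul_mem hk (inv_mem hg), ?_⟩
  simp [Fin.forall_fin_two, ← hg0, ← hg1, hk0, hk1]

theorem cycle4_mul_cycle4_sq :
    (cycle4 (4 : Fin 11) 5 3 9 * cycle4 10 7 2 6) ^ 2 = quadSwap := by
  ext1 x
  revert x
  decide +kernel

theorem biplaneGroup_le :
    biplaneGroup ≤
      Subgroup.closure {finRotate 11, cycle4 (4 : Fin 11) 5 3 9 * cycle4 10 7 2 6} := by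
  refine (Subgroup.closure_le _).mpr ?_
  rintro g (rfl | rfl)
  · exact Subgroup.subset_closure (Or.inl rfl)
  · rw [SetLike.mem_coe, ← cycle4_mul_cycle4_sq]
    refine pow_mem (Subgroup.subset_closure ?_) 2
    exact Or.inr rfl

/-- The Mathieu group `M11`, generated by `(0 1 2 3 4 5 6 7 8 9 10)` and
`(4 5 3 9)(10 7 2 6)`, contains the 2-transitive group of order 660 generated by
`(0 1 2 3 4 5 6 7 8 9 10)` and `(4 3)(5 9)(10 2)(7 6)`. -/
theorem M11_contains_order_660_group :
    Subgroup.closure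
        {finRotate 11,
          Equiv.swap (4 : Fin 11) 3 * Equiv.swap 5 9 * Equiv.swap 10 2 * Equiv.swap 7 6} ≤
      Subgroup.closure {finRotate 11, cycle4 (4 : Fin 11) 5 3 9 * cycle4 10 7 2 6} ∧
    Nat.card (Subgroup.closure
        {finRotate 11,
          Equiv.swap (4 : Fin 11) 3 * Equiv.swap 5 9 * Equiv.swap 10 2 * Equiv.swap 7 6})
      = 660 ∧
    IsMultiplyTransitive
      (Subgroup.closure
        {finRotate 11,
          Equiv.swap (4 : Fin 11) 3 * Equiv.swap 5 9 * Equiv.swap 10 2 * Equiv.swap 7 6})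
      2 := by
  exact ⟨biplaneGroup_le, card_biplaneGroup, isMultiplyTransitive_biplaneGroup⟩
end
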